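/- arXiv:1605.01064 — 3 statements merged into one kernel-verified Lean document; each statement's English description precedes it below -/
import Mathlib

section
/- Let (R, →) be a resource theory with a currency (𝒞, Val, Ω) for a target 𝒮, and let V, W ∈ 𝒮. Assume the set {Val C : C ∈ 𝒞 ∧ V → C} is bounded above. If Yield(V) > Cost(W), then V → W. -/
/-- The cost of a resource `V`: the infimum of values of currency resources that can
produce `V`. -/
noncomputable def RTCost {R : Type*} (arrow : R → R → Prop) (𝒞 : Set R) (Val : R → ℝ)
    (V : R) : ℝ :=
  sInf {x : ℝ | ∃ C ∈ 𝒞, arrow C V ∧ Val C = x}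

/-- The yield of a resource `V`: the supremum of values of currency resources that
can be extracted from `V`. -/
noncomputable def RTYield {R : Type*} (arrow : R → R → Prop) (𝒞 : Set R) (Val : R → ℝ)
    (V : R) : ℝ :=
  sSup {x : ℝ | ∃ C ∈ 𝒞, arrow V C ∧ Val C = x}

/-- If `Yield(V) > Cost(W)` then `V → W`. -/
theorem stmt1 {R : Type*} (arrow : R → R → Prop)
    (hrefl : ∀ a, arrow a a)
    (htrans : ∀ a b c, arrow a b → arrow b c → arrow a c)
    (𝒞 𝒮 : Set R) (Ω : R) (Val : R → ℝ)
    (hΩC : Ω ∈ 𝒞) (hΩS : Ω ∈ 𝒮)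
    (hVal_nonneg : ∀ C ∈ 𝒞, 0 ≤ Val C) (hValΩ : Val Ω = 0)
    (horder : ∀ C ∈ 𝒞, ∀ C' ∈ 𝒞, (Val C' ≤ Val C ↔ arrow C C'))
    (huniv : ∀ V ∈ 𝒮, (∃ C ∈ 𝒞, arrow C V) ∧ (∃ C' ∈ 𝒞, arrow V C'))
    (V W : R) (hV : V ∈ 𝒮) (hW : W ∈ 𝒮)
    (hbdd : BddAbove {x : ℝ | ∃ C ∈ 𝒞, arrow V C ∧ Val C = x})
    (hgt : RTCost arrow 𝒞 Val W < RTYield arrow 𝒞 Val V) :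
    arrow V W := by
  unfold RTCost RTYield at hgt
  obtain ⟨C₀, hC₀, hC₀W⟩ := (huniv W hW).1
  obtain ⟨D₀, hD₀, hVD₀⟩ := (huniv V hV).2
  obtain ⟨_, ⟨C, hC, hVC, rfl⟩, hWC⟩ :=
    exists_lt_of_lt_csSup (by exact ⟨_, D₀, hD₀, hVD₀, rfl⟩) hgt
  obtain ⟨_, ⟨D, hD, hDW, rfl⟩, hDC⟩ :=
    exists_lt_of_csInf_lt (by exact ⟨_, C₀, hC₀, hC₀W, rfl⟩) hWC
  exact htrans _ _ _ hVC (htrans _ _ _ ((horder C hC D hD).1 hDC.le) hDW)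
end

section
/- Let (R, →) be a resource theory with a currency (𝒞, Val, Ω) for a target 𝒮, and let V ∈ 𝒮 be such that the set {Val C : C ∈ 𝒞 ∧ V → C} is bounded above. Then Cost(V) ≥ Yield(V). -/
/-- `Cost(V) ≥ Yield(V)`. -/
theorem stmt4 {R : Type*} (arrow : R → R → Prop)
    (hrefl : ∀ a, arrow a a)
    (htrans : ∀ a b c, arrow a b → arrow b c → arrow a c)
    (𝒞 𝒮 : Set R) (Ω : R) (Val : R → ℝ)
    (hΩC : Ω ∈ 𝒞) (hΩS : Ω ∈ 𝒮)
    (hVal_nonneg : ∀ C ∈ 𝒞, 0 ≤ Val C) (hValΩ : Val Ω = 0)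
    (horder : ∀ C ∈ 𝒞, ∀ C' ∈ 𝒞, (Val C' ≤ Val C ↔ arrow C C'))
    (huniv : ∀ V ∈ 𝒮, (∃ C ∈ 𝒞, arrow C V) ∧ (∃ C' ∈ 𝒞, arrow V C'))
    (V : R) (hV : V ∈ 𝒮)
    (hbdd : BddAbove {x : ℝ | ∃ C ∈ 𝒞, arrow V C ∧ Val C = x}) :
    RTYield arrow 𝒞 Val V ≤ RTCost arrow 𝒞 Val V := by
  obtain ⟨⟨A, hA, hAV⟩, B, hB, hVB⟩ := huniv V hV
  refine csSup_le ⟨_, B, hB, hVB, rfl⟩ ?_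
  rintro _ ⟨C', hC', hVC', rfl⟩
  refine le_csInf ⟨_, A, hA, hAV, rfl⟩ ?_
  rintro _ ⟨C, hC, hCV, rfl⟩
  exact (horder C hC C' hC').2 (htrans C V C' hCV hVC')
end

section
/- Let (R, →) be a resource theory with a currency (𝒞, Val, Ω) for a target 𝒮, and assume for each V ∈ 𝒮 the set {Val C : C ∈ 𝒞 ∧ V → C} is bounded above. Say the currency is tight for V ∈ 𝒮 if there exists C ∈ 𝒞 with C → V and V → C. If the currency is tight for both V and W, then V → W if and only if Cost(V) ≥ Cost(W). In particular, for any two resources for which the currency is tight, either V → W or W → V. -/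
/-- The cost of a resource interconvertible with a currency resource is the value of the latter. -/
theorem RTCost_eq_val_of_interconvertible {R : Type*} {arrow : R → R → Prop}
    (htrans : ∀ a b c, arrow a b → arrow b c → arrow a c)
    {𝒞 : Set R} {Val : R → ℝ}
    (horder : ∀ C ∈ 𝒞, ∀ C' ∈ 𝒞, (Val C' ≤ Val C ↔ arrow C C'))
    {C V : R} (hC : C ∈ 𝒞) (hCV : arrow C V) (hVC : arrow V C) :
    RTCost arrow 𝒞 Val V = Val C := by
  refine IsLeast.csInf_eq ⟨⟨C, hC, hCV, rfl⟩, ?_⟩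
  rintro _ ⟨D, hD, hDV, rfl⟩
  exact (horder D hD C hC).mpr (htrans D V C hDV hVC)

/-- If the currency is tight for both `V` and `W` (there is a currency
resource interconvertible with each), then `V → W ↔ Cost(V) ≥ Cost(W)`; in particular,
either `V → W` or `W → V`. -/
theorem stmt5 {R : Type*} (arrow : R → R → Prop)
    (hrefl : ∀ a, arrow a a)
    (htrans : ∀ a b c, arrow a b → arrow b c → arrow a c)
    (𝒞 𝒮 : Set R) (Ω : R) (Val : R → ℝ)
    (hΩC : Ω ∈ 𝒞) (hΩS : Ω ∈ 𝒮)
    (hVal_nonneg : ∀ C ∈ 𝒞, 0 ≤ Val C) (hValΩ : Val Ω = 0)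
    (horder : ∀ C ∈ 𝒞, ∀ C' ∈ 𝒞, (Val C' ≤ Val C ↔ arrow C C'))
    (huniv : ∀ V ∈ 𝒮, (∃ C ∈ 𝒞, arrow C V) ∧ (∃ C' ∈ 𝒞, arrow V C'))
    (hbdd : ∀ V ∈ 𝒮, BddAbove {x : ℝ | ∃ C ∈ 𝒞, arrow V C ∧ Val C = x})
    (V W : R) (hV : V ∈ 𝒮) (hW : W ∈ 𝒮)
    (htightV : ∃ C ∈ 𝒞, arrow C V ∧ arrow V C)
    (htightW : ∃ C ∈ 𝒞, arrow C W ∧ arrow W C) :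
    (arrow V W ↔ RTCost arrow 𝒞 Val W ≤ RTCost arrow 𝒞 Val V) ∧
      (arrow V W ∨ arrow W V) := by
  obtain ⟨C, hC, hCV, hVC⟩ := htightV
  obtain ⟨D, hD, hDW, hWD⟩ := htightW
  have key : ∀ {A B X Y : R}, arrow A X → arrow X A → arrow B Y → arrow Y B →
      (arrow X Y ↔ arrow A B) := fun hAX hXA hBY hYB =>
    ⟨fun h => htrans _ _ _ (htrans _ _ _ hAX h) hYB,
      fun h => htrans _ _ _ (htrans _ _ _ hXA h) hBY⟩
  rw [RTCost_eq_val_of_interconvertible htrans horder hC hCV hVC,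
    RTCost_eq_val_of_interconvertible htrans horder hD hDW hWD,
    key hCV hVC hDW hWD, key hDW hWD hCV hVC, ← horder C hC D hD, ← horder D hD C hC]
  exact ⟨Iff.rfl, le_total _ _⟩
end
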